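/- Let (C, S, N, f) be an automaton with f commutative. Let η be an asynchronous trajectory and let A₀ ⊆ L(0,η) \ U(0,η). Then there is an asynchronous trajectory η′ with initial configuration η′(·,0) = η(·,0) that dominates η and satisfies U(0,η′) = U(0,η) ∪ A₀. -/

import Mathlib

namespace AsyncUpdating

variable {C S : Type*}

/-- `f` is a transition function for the neighborhood function `N`:
`f ξ x` depends only on the restriction of `ξ` to `N x`. -/
def IsTransition (N : C → Set C) (f : (C → S) → C → S) : Prop :=
  ∀ (ξ₁ ξ₂ : C → S) (x : C), (∀ y ∈ N x, ξ₁ y = ξ₂ y) → f ξ₁ x = f ξ₂ x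

/-- The automaton is local: every neighborhood is finite. -/
def IsLocal (N : C → Set C) : Prop := ∀ x, (N x).Finite

open Classical in
/-- `upd f ξ E` is the configuration `f(ξ, E)`: apply `f` at the sites of `E` only. -/
noncomputable def upd (f : (C → S) → C → S) (ξ : C → S) (E : Set C) : C → S :=
  fun x => if x ∈ E then f ξ x else ξ x

/-- The set `L(ξ)` of free sites. -/
def freeSet (f : (C → S) → C → S) (ξ : C → S) : Set C := {x | f ξ x ≠ ξ x}

/-- `η` is an asynchronous trajectory of `f`. -/
def IsAsyncTraj (f : (C → S) → C → S) (η : C → ℕ → S) : Prop :=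
  ∀ x t, η x (t + 1) ≠ η x t → η x (t + 1) = f (fun y => η y t) x

/-- `η` is a synchronous trajectory of `f`. -/
def IsSyncTraj (f : (C → S) → C → S) (η : C → ℕ → S) : Prop :=
  ∀ x t, η x (t + 1) = f (fun y => η y t) x

/-- The synchronous trajectory of `f` with initial configuration `ξ`. -/
def syncTraj (f : (C → S) → C → S) (ξ : C → S) : ℕ → C → S
  | 0 => ξ
  | t + 1 => f (syncTraj f ξ t)

/-- The update set `U(t, η)`. -/
def updSet (η : C → ℕ → S) (t : ℕ) : Set C := {x | η x (t + 1) ≠ η x t}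

open Classical in
/-- The effective age `τ(x, t, η)`: the number of `s < t` with `x ∈ U(s, η)`. -/
noncomputable def effAge (η : C → ℕ → S) (x : C) (t : ℕ) : ℕ :=
  ((Finset.range t).filter fun s => η x (s + 1) ≠ η x s).card

/-- `f` has invariant histories. -/
def InvariantHistories (f : (C → S) → C → S) : Prop :=
  ∀ ξ : C → S, ∃ ζ : C → ℕ → S, ∀ η : C → ℕ → S,
    IsAsyncTraj f η → (∀ x, η x 0 = ξ x) → ∀ x t, η x t = ζ x (effAge η x t)

/-- `f` is monotonic: `L(t,η) \ U(t,η) ⊆ L(t+1,η)` for every asynchronous trajectory. -/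
def Monotonic (f : (C → S) → C → S) : Prop :=
  ∀ η : C → ℕ → S, IsAsyncTraj f η → ∀ t,
    freeSet f (fun x => η x t) \ updSet η t ⊆ freeSet f (fun x => η x (t + 1))

/-- `f` is commutative. -/
def CommutativeRule (f : (C → S) → C → S) : Prop :=
  ∀ (ξ : C → S) (A B : Set C), Disjoint A B →
    A ⊆ freeSet f ξ → B ⊆ freeSet f ξ →
    upd f (upd f ξ A) B = upd f ξ (A ∪ B)

/-- `f` is locally commutative. -/
def LocallyCommutative (f : (C → S) → C → S) : Prop :=
  ∀ (ξ : C → S) (x y : C), x ≠ y → x ∈ freeSet f ξ → y ∈ freeSet f ξ →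
    upd f (upd f ξ {x}) {y} = upd f ξ {x, y}

/-- `η₁` dominates `η₀` (they are assumed to have the same initial configuration). -/
def Dominates (η₁ η₀ : C → ℕ → S) : Prop :=
  (∀ x t, effAge η₀ x t ≤ effAge η₁ x t) ∧
  (∀ x t₀ t₁, effAge η₀ x t₀ = effAge η₁ x t₁ → η₀ x t₀ = η₁ x t₁)

theorem effAge_zero (η : C → ℕ → S) (x : C) : effAge η x 0 = 0 := by
  simp [effAge]

open Classical in
theorem effAge_succ (η : C → ℕ → S) (x : C) (t : ℕ) :
    effAge η x (t + 1) = effAge η x t + if x ∈ updSet η t then 1 else 0 := by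
  unfold effAge updSet
  rw [Finset.range_add_one, Finset.filter_insert]
  by_cases h : η x (t + 1) = η x t <;> simp [h]

theorem effAge_mono (η : C → ℕ → S) (x : C) : Monotone (effAge η x) :=
  monotone_nat_of_le_succ fun t => by rw [effAge_succ]; omega

theorem eq_of_effAge_eq_of_le {η : C → ℕ → S} {x : C} {s t : ℕ} (hst : s ≤ t)
    (h : effAge η x s = effAge η x t) : η x s = η x t := by
  induction t, hst using Nat.le_induction with
  | base => rfl
  | succ t hst ih =>
    have h₁ := effAge_mono η x hst
    rw [effAge_succ] at h
    split_ifs at h with hx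
    · omega
    · exact (ih h).trans (not_not.mp hx).symm

theorem eq_of_effAge_eq {η : C → ℕ → S} {x : C} {s t : ℕ}
    (h : effAge η x s = effAge η x t) : η x s = η x t :=
  (le_total s t).elim (fun hst => eq_of_effAge_eq_of_le hst h)
    fun hts => (eq_of_effAge_eq_of_le hts h.symm).symm

theorem upd_of_mem {f : (C → S) → C → S} {ξ : C → S} {E : Set C} {x : C} (hx : x ∈ E) :
    upd f ξ E x = f ξ x := if_pos hx

theorem upd_of_notMem {f : (C → S) → C → S} {ξ : C → S} {E : Set C} {x : C} (hx : x ∉ E) :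
    upd f ξ E x = ξ x := if_neg hx

/-- Updating free sites outside `B` keeps the sites of `B` free. -/
theorem CommutativeRule.subset_freeSet_upd {f : (C → S) → C → S} (hc : CommutativeRule f)
    {ξ : C → S} {A B : Set C} (hAB : Disjoint A B) (hA : A ⊆ freeSet f ξ)
    (hB : B ⊆ freeSet f ξ) : B ⊆ freeSet f (upd f ξ A) := by
  intro x hx
  have h := congrFun (hc ξ A B hAB hA hB) x
  rw [upd_of_mem hx, upd_of_mem (Set.mem_union_right A hx)] at h
  change f (upd f ξ A) x ≠ upd f ξ A x
  rw [h, upd_of_notMem fun hxA => hAB.le_bot ⟨hxA, hx⟩]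
  exact hB hx

theorem IsAsyncTraj.updSet_subset_freeSet {f : (C → S) → C → S} {η : C → ℕ → S}
    (hη : IsAsyncTraj f η) (t : ℕ) : updSet η t ⊆ freeSet f (fun x => η x t) := by
  intro x hx
  change f (fun y => η y t) x ≠ η x t
  rw [← hη x t hx]
  exact hx

theorem IsAsyncTraj.eq_upd {f : (C → S) → C → S} {η : C → ℕ → S}
    (hη : IsAsyncTraj f η) (t : ℕ) :
    (fun x => η x (t + 1)) = upd f (fun x => η x t) (updSet η t) := by
  funext x
  by_cases hx : x ∈ updSet η t
  · rw [upd_of_mem hx]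
    exact hη x t hx
  · rw [upd_of_notMem hx]
    exact not_not.mp hx

theorem updSet_eq_of_eq_upd {f : (C → S) → C → S} {η : C → ℕ → S} {t : ℕ} {E : Set C}
    (hE : E ⊆ freeSet f (fun x => η x t))
    (h : (fun x => η x (t + 1)) = upd f (fun x => η x t) E) : updSet η t = E := by
  ext x
  change η x (t + 1) ≠ η x t ↔ x ∈ E
  rw [show η x (t + 1) = upd f (fun y => η y t) E x from congrFun h x]
  by_cases hx : x ∈ E
  · rw [upd_of_mem hx]
    exact iff_of_true (hE hx) hx
  · simp [upd_of_notMem hx, hx]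

theorem isAsyncTraj_of_eq_upd {f : (C → S) → C → S} {η : C → ℕ → S} (E : ℕ → Set C)
    (h : ∀ t, (fun x => η x (t + 1)) = upd f (fun x => η x t) (E t)) : IsAsyncTraj f η := by
  intro x t hx
  have h' : η x (t + 1) = upd f (fun y => η y t) (E t) x := congrFun (h t) x
  by_cases hE : x ∈ E t
  · rwa [upd_of_mem hE] at h'
  · rw [upd_of_notMem hE] at h'
    exact absurd h' hx

/-- The sites of `A` that `η` has not updated before time `t`. -/
def pending (η : C → ℕ → S) (A : Set C) (t : ℕ) : Set C := {x | x ∈ A ∧ effAge η x t = 0}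

theorem pending_zero (η : C → ℕ → S) (A : Set C) : pending η A 0 = A := by
  simp [pending, effAge_zero]

theorem pending_succ (η : C → ℕ → S) (A : Set C) (t : ℕ) :
    pending η A (t + 1) = pending η A t \ updSet η t := by
  ext x
  simp only [pending, Set.mem_ofPred_eq, Set.mem_sdiff, effAge_succ]
  split_ifs with h <;> simp [h]

theorem pending_subset_freeSet {f : (C → S) → C → S} (hc : CommutativeRule f)
    {η : C → ℕ → S} (hη : IsAsyncTraj f η) {A : Set C}
    (hA : A ⊆ freeSet f (fun x => η x 0)) (t : ℕ) :
    pending η A t ⊆ freeSet f (fun x => η x t) := by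
  induction t with
  | zero => rwa [pending_zero]
  | succ t ih =>
    rw [pending_succ, hη.eq_upd]
    exact hc.subset_freeSet_upd Set.disjoint_sdiff_right (hη.updSet_subset_freeSet t)
      (Set.sdiff_subset.trans ih)

/-- Updating the pending sites after one more step of `η` amounts to updating both the pending
sites and those updated by `η`. -/
theorem upd_pending_succ {f : (C → S) → C → S} (hc : CommutativeRule f)
    {η : C → ℕ → S} (hη : IsAsyncTraj f η) {A : Set C}
    (hA : A ⊆ freeSet f (fun x => η x 0)) (t : ℕ) :
    upd f (fun x => η x (t + 1)) (pending η A (t + 1)) =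
      upd f (fun x => η x t) (updSet η t ∪ pending η A t) := by
  rw [pending_succ, hη.eq_upd, hc _ _ _ Set.disjoint_sdiff_right (hη.updSet_subset_freeSet t)
    (Set.sdiff_subset.trans (pending_subset_freeSet hc hη hA t)), Set.union_sdiff_self]

/-- The trajectory `η` modified so that the sites of `A` get their first update at time `0`. -/
noncomputable def advance (f : (C → S) → C → S) (η : C → ℕ → S) (A : Set C) : C → ℕ → S
  | x, 0 => η x 0
  | x, t + 1 => upd f (fun y => η y (t + 1)) (pending η A (t + 1)) x

/-- The update sets of `advance f η A`. -/
def advanceSet (η : C → ℕ → S) (A : Set C) : ℕ → Set C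
  | 0 => updSet η 0 ∪ A
  | t + 1 => updSet η (t + 1) \ pending η A (t + 1)

section Advance

variable {f : (C → S) → C → S} {η : C → ℕ → S} {A : Set C}

theorem advance_eq_upd (hc : CommutativeRule f) (hη : IsAsyncTraj f η)
    (hA : A ⊆ freeSet f (fun x => η x 0)) (t : ℕ) :
    (fun x => advance f η A x (t + 1)) =
      upd f (fun x => advance f η A x t) (advanceSet η A t) := by
  change upd f (fun x => η x (t + 1)) (pending η A (t + 1)) = _
  rw [upd_pending_succ hc hη hA]
  cases t with
  | zero => rw [pending_zero]; rfl
  | succ t =>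
    rw [Set.union_comm, ← Set.union_sdiff_self]
    exact (hc _ _ _ Set.disjoint_sdiff_right (pending_subset_freeSet hc hη hA _)
      (Set.sdiff_subset.trans (hη.updSet_subset_freeSet _))).symm

theorem advanceSet_subset_freeSet (hc : CommutativeRule f) (hη : IsAsyncTraj f η)
    (hA : A ⊆ freeSet f (fun x => η x 0)) (t : ℕ) :
    advanceSet η A t ⊆ freeSet f (fun x => advance f η A x t) := by
  cases t with
  | zero => exact Set.union_subset (hη.updSet_subset_freeSet 0) hA
  | succ t =>
    exact hc.subset_freeSet_upd Set.disjoint_sdiff_right (pending_subset_freeSet hc hη hA _)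
      (Set.sdiff_subset.trans (hη.updSet_subset_freeSet _))

theorem updSet_advance (hc : CommutativeRule f) (hη : IsAsyncTraj f η)
    (hA : A ⊆ freeSet f (fun x => η x 0)) (t : ℕ) :
    updSet (advance f η A) t = advanceSet η A t :=
  updSet_eq_of_eq_upd (advanceSet_subset_freeSet hc hη hA t) (advance_eq_upd hc hη hA t)

theorem advance_of_notMem {x : C} {t : ℕ} (hx : x ∉ pending η A t) :
    advance f η A x t = η x t := by
  cases t with
  | zero => rfl
  | succ t => exact upd_of_notMem hx

open Classical in
theorem effAge_advance_succ (hc : CommutativeRule f) (hη : IsAsyncTraj f η)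
    (hA : A ⊆ freeSet f (fun x => η x 0)) (hd : Disjoint A (updSet η 0)) (x : C) (t : ℕ) :
    effAge (advance f η A) x (t + 1) =
      effAge η x (t + 1) + if x ∈ pending η A (t + 1) then 1 else 0 := by
  induction t with
  | zero =>
    have hx : ¬ (x ∈ A ∧ x ∈ updSet η 0) := fun h => hd.le_bot h
    rw [effAge_succ, effAge_succ, updSet_advance hc hη hA, pending_succ, pending_zero,
      effAge_zero, effAge_zero]
    simp only [advanceSet, Set.mem_union, Set.mem_sdiff]
    by_cases h₁ : x ∈ A <;> by_cases h₂ : x ∈ updSet η 0 <;> simp_all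
  | succ t ih =>
    rw [effAge_succ, ih, effAge_succ η x (t + 1), updSet_advance hc hη hA,
      pending_succ η A (t + 1)]
    simp only [advanceSet, Set.mem_sdiff]
    by_cases h₁ : x ∈ pending η A (t + 1) <;> by_cases h₂ : x ∈ updSet η (t + 1) <;>
      simp [h₁, h₂]

theorem advance_dominates (hc : CommutativeRule f) (hη : IsAsyncTraj f η)
    (hA : A ⊆ freeSet f (fun x => η x 0)) (hd : Disjoint A (updSet η 0)) :
    Dominates (advance f η A) η := by
  have age := effAge_advance_succ hc hη hA hd
  have age_of_notMem : ∀ x t, x ∉ pending η A t →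
      effAge (advance f η A) x t = effAge η x t := by
    intro x t hx
    cases t with
    | zero => simp only [effAge_zero]
    | succ t => rw [age, if_neg hx, add_zero]
  refine ⟨fun x t => ?_, fun x t₀ t₁ h => ?_⟩
  · cases t with
    | zero => simp only [effAge_zero, le_refl]
    | succ t => rw [age]; exact Nat.le_add_right _ _
  · by_cases h₀ : x ∈ pending η A t₀
    · have h₁ : η x t₀ = η x 0 := eq_of_effAge_eq (h₀.2.trans (effAge_zero η x).symm)
      have h₂ : advance f η A x t₁ = advance f η A x 0 :=
        eq_of_effAge_eq ((h.symm.trans h₀.2).trans (effAge_zero _ x).symm)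
      exact h₁.trans h₂.symm
    · rw [← advance_of_notMem (f := f) h₀]
      exact eq_of_effAge_eq ((age_of_notMem x t₀ h₀).trans h)

end Advance

/-- Let (C, S, N, f) be an automaton with f commutative. Let η be an
asynchronous trajectory and let A₀ ⊆ L(0,η) \ U(0,η). Then there is an asynchronous
trajectory η′ with initial configuration η′(·,0) = η(·,0) that dominates η and
satisfies U(0,η′) = U(0,η) ∪ A₀. -/
theorem exists_dominating_trajectory
    {C S : Type*} (N : C → Set C) (f : (C → S) → C → S)
    (hf : IsTransition N f) (hc : CommutativeRule f)
    (η : C → ℕ → S) (hη : IsAsyncTraj f η)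
    (A₀ : Set C) (hA₀ : A₀ ⊆ freeSet f (fun x => η x 0) \ updSet η 0) :
    ∃ η' : C → ℕ → S, IsAsyncTraj f η' ∧ (∀ x, η' x 0 = η x 0) ∧
      Dominates η' η ∧ updSet η' 0 = updSet η 0 ∪ A₀ := by
  have hA : A₀ ⊆ freeSet f (fun x => η x 0) := hA₀.trans Set.sdiff_subset
  have hd : Disjoint A₀ (updSet η 0) := Set.disjoint_left.mpr fun _ hx => (hA₀ hx).2
  exact ⟨advance f η A₀, isAsyncTraj_of_eq_upd _ (advance_eq_upd hc hη hA), fun _ => rfl,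
    advance_dominates hc hη hA hd, updSet_advance hc hη hA 0⟩

end AsyncUpdating
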